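/- With I(α) = ∫_{X/2}^{X} e(α·y·log y) dy, N = 2X·log(2X/3), ε = X^{−1/25}(log X)^8, and Ψ the Fourier transform of the bump function ψ from Tolev's lemma, one has ∫_{−∞}^{∞} I(α)³·e(−Nα)·Ψ(α) dα ≫ ε·X²/log X for X sufficiently large. -/

import Mathlib

noncomputable def Iint (X α : ℝ) : ℂ :=
  ∫ y in (X / 2)..X, Complex.exp (2 * Real.pi * Complex.I * (α * y * Real.log y))

open MeasureTheory Set Filter
open scoped FourierTransform

/-- The interval measure. -/
noncomputable def nuX (X : ℝ) : Measure ℝ := volume.restrict (Ioc (X / 2) X)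

instance (X : ℝ) : IsFiniteMeasure (nuX X) := by unfold nuX; infer_instance

noncomputable def mX (X : ℝ) : Measure (ℝ × ℝ × ℝ) := (nuX X).prod ((nuX X).prod (nuX X))

instance (X : ℝ) : IsFiniteMeasure (mX X) := by unfold mX; infer_instance

noncomputable def SX (p : ℝ × ℝ × ℝ) : ℝ :=
  p.1 * Real.log p.1 + (p.2.1 * Real.log p.2.1 + p.2.2 * Real.log p.2.2)

lemma SX_cont : Continuous SX := by
  unfold SX
  exact (Real.continuous_mul_log.comp continuous_fst).add
    ((Real.continuous_mul_log.comp (continuous_fst.comp continuous_snd)).add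
      (Real.continuous_mul_log.comp (continuous_snd.comp continuous_snd)))

lemma Iint_bound {X : ℝ} (hX : 2 ≤ X) {α : ℝ} (hα : α ≠ 0) :
    ‖Iint X α‖ * |α| ≤ 2 + X := by
  have hpi := Real.pi_gt_three
  have hab : X / 2 ≤ X := by linarith
  have hc : (2 * Real.pi * Complex.I * α : ℂ) ≠ 0 := by
    simp [hα, Real.pi_ne_zero, Complex.I_ne_zero]
  set v : ℝ → ℂ := fun y => Complex.exp (2 * Real.pi * Complex.I * (α * y * Real.log y)) /
    (2 * Real.pi * Complex.I * α) with hv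
  set v' : ℝ → ℂ := fun y => Complex.exp (2 * Real.pi * Complex.I * (α * y * Real.log y)) *
    ((Real.log y + 1 : ℝ) : ℂ) with hv'
  set u : ℝ → ℂ := fun y => (((Real.log y + 1)⁻¹ : ℝ) : ℂ) with hu
  set u' : ℝ → ℂ := fun y => ((-(y⁻¹) / (Real.log y + 1) ^ 2 : ℝ) : ℂ) with hu'
  have hmem : ∀ y ∈ uIcc (X / 2) X, 1 ≤ y := by
    intro y hy
    rw [uIcc_of_le hab] at hy
    linarith [hy.1]
  have hlog : ∀ y ∈ uIcc (X / 2) X, 0 ≤ Real.log y := fun y hy => Real.log_nonneg (hmem y hy)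
  have hud : ∀ y ∈ uIcc (X / 2) X, HasDerivAt u (u' y) y := by
    intro y hy
    have h1 := hmem y hy
    have h2 := hlog y hy
    exact (((Real.hasDerivAt_log (by linarith)).add_const 1).inv (by linarith)).ofReal_comp
  have hvd : ∀ y ∈ uIcc (X / 2) X, HasDerivAt v (v' y) y := by
    intro y hy
    have h1 := hmem y hy
    have h3 := (Real.hasDerivAt_mul_log (x := y) (by linarith)).ofReal_comp
    have h4 := ((h3.const_mul (2 * Real.pi * Complex.I * α : ℂ)).cexp).div_const
      (2 * Real.pi * Complex.I * α : ℂ)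
    have e1 : v = fun x : ℝ => Complex.exp (2 * Real.pi * Complex.I * α * ((x * Real.log x : ℝ) : ℂ)) /
        (2 * Real.pi * Complex.I * α) := by
      funext z
      simp only [hv]
      push_cast
      ring_nf
    rw [e1]
    refine h4.congr_deriv ?_
    simp only [hv']
    rw [mul_div_assoc, mul_div_cancel_left₀ _ hc]
    push_cast
    ring_nf
  have hexpn : ∀ y : ℝ, ‖Complex.exp (2 * Real.pi * Complex.I * (α * y * Real.log y))‖ = 1 := by
    intro y
    rw [show (2 * Real.pi * Complex.I * (α * y * Real.log y) : ℂ)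
      = ((2 * Real.pi * (α * y * Real.log y) : ℝ) : ℂ) * Complex.I by push_cast; ring]
    exact Complex.norm_exp_ofReal_mul_I _
  have hcontl : ContinuousOn Real.log (uIcc (X / 2) X) :=
    Real.continuousOn_log.mono (fun y hy => by have := hmem y hy; simp; linarith)
  have hcu' : ContinuousOn u' (uIcc (X / 2) X) := by
    apply Complex.continuous_ofReal.comp_continuousOn
    apply ContinuousOn.div
    · exact (continuousOn_id.inv₀ (fun y hy => by have := hmem y hy; simp; linarith)).neg
    · exact (hcontl.add continuousOn_const).pow 2
    · intro y hy; have := hlog y hy; positivity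
  have hcv' : ContinuousOn v' (uIcc (X / 2) X) := by
    apply ContinuousOn.mul
    · apply Complex.continuous_exp.comp_continuousOn
      apply continuousOn_const.mul
      exact (continuousOn_const.mul Complex.continuous_ofReal.continuousOn).mul
        (Complex.continuous_ofReal.comp_continuousOn hcontl)
    · exact Complex.continuous_ofReal.comp_continuousOn (hcontl.add continuousOn_const)
  have key := intervalIntegral.integral_mul_deriv_eq_deriv_mul hud hvd
    hcu'.intervalIntegrable hcv'.intervalIntegrable
  have hI : Iint X α = ∫ y in (X / 2)..X, u y * v' y := by
    unfold Iint
    apply intervalIntegral.integral_congr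
    intro y hy
    have h2 := hlog y hy
    have h5 : ((Real.log y + 1 : ℝ) : ℂ) ≠ 0 := by
      exact_mod_cast (by linarith : Real.log y + 1 ≠ 0)
    simp only [hu, hv']
    rw [Complex.ofReal_inv]
    field_simp
  have hvn : ∀ y, ‖v y‖ ≤ |α|⁻¹ := by
    intro y
    simp only [hv]
    rw [norm_div, hexpn]
    have : ‖(2 * Real.pi * Complex.I * α : ℂ)‖ = 2 * Real.pi * |α| := by
      simp [abs_of_pos Real.pi_pos]
    rw [this, one_div]
    have := abs_pos.mpr hα
    apply inv_anti₀ this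
    nlinarith
  have hun : ∀ y ∈ uIcc (X / 2) X, ‖u y‖ ≤ 1 := by
    intro y hy
    have h2 := hlog y hy
    simp only [hu]
    rw [Complex.norm_real, Real.norm_eq_abs, abs_of_nonneg (by positivity)]
    exact inv_le_one_of_one_le₀ (by linarith)
  have hun' : ∀ y ∈ uIcc (X / 2) X, ‖u' y‖ ≤ 1 := by
    intro y hy
    have h2 := hlog y hy
    have h1 := hmem y hy
    simp only [hu']
    rw [Complex.norm_real, Real.norm_eq_abs, abs_div, abs_neg, abs_of_nonneg (by positivity),
      abs_of_nonneg (by positivity)]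
    apply div_le_one_of_le₀ _ (by positivity)
    have := inv_le_one_of_one_le₀ h1
    nlinarith
  have hbnd : ‖∫ y in (X / 2)..X, u' y * v y‖ ≤ |α|⁻¹ * |X - X / 2| := by
    apply intervalIntegral.norm_integral_le_of_norm_le_const
    intro y hy
    have hy' := uIoc_subset_uIcc hy
    rw [norm_mul]
    calc _ ≤ 1 * |α|⁻¹ := mul_le_mul (hun' y hy') (hvn y) (norm_nonneg _) zero_le_one
      _ = _ := one_mul _
  have hb : ∀ y ∈ uIcc (X / 2) X, ‖u y * v y‖ ≤ |α|⁻¹ := by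
    intro y hy
    rw [norm_mul]
    calc _ ≤ 1 * |α|⁻¹ := mul_le_mul (hun y hy) (hvn y) (norm_nonneg _) zero_le_one
      _ = _ := one_mul _
  have hapos := abs_pos.mpr hα
  have : ‖Iint X α‖ ≤ |α|⁻¹ * (2 + X) := by
    rw [hI, key]
    have e1 := norm_sub_le (u X * v X - u (X / 2) * v (X / 2)) (∫ y in (X / 2)..X, u' y * v y)
    have e2 := norm_sub_le (u X * v X) (u (X / 2) * v (X / 2))
    have e3 := hb X right_mem_uIcc
    have e4 := hb (X / 2) left_mem_uIcc
    rw [abs_of_nonneg (by linarith : (0 : ℝ) ≤ X - X / 2)] at hbnd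
    have : 0 < |α|⁻¹ := by positivity
    nlinarith
  calc _ ≤ |α|⁻¹ * (2 + X) * |α| := by gcongr
    _ = _ := by field_simp

lemma Iint_bound' {X : ℝ} (hX : 2 ≤ X) (α : ℝ) : ‖Iint X α‖ ≤ X := by
  have : ‖Iint X α‖ ≤ 1 * |X - X / 2| := by
    apply intervalIntegral.norm_integral_le_of_norm_le_const
    intro y hy
    rw [show (2 * Real.pi * Complex.I * (α * y * Real.log y) : ℂ)
      = ((2 * Real.pi * (α * y * Real.log y) : ℝ) : ℂ) * Complex.I by push_cast; ring]
    exact (Complex.norm_exp_ofReal_mul_I _).le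
  rw [abs_of_nonneg (by linarith)] at this
  linarith

lemma Iint_cube {X : ℝ} (hX : 2 ≤ X) (α : ℝ) :
    (Iint X α) ^ 3 = ∫ p, Complex.exp (2 * Real.pi * Complex.I * (α * SX p)) ∂(mX X) := by
  have h0 : Iint X α = ∫ y, Complex.exp (2 * Real.pi * Complex.I * (α * y * Real.log y)) ∂(nuX X) := by
    unfold Iint nuX
    rw [intervalIntegral.integral_of_le (by linarith)]
  set E : ℝ → ℂ := fun y => Complex.exp (2 * Real.pi * Complex.I * (α * y * Real.log y)) with hE
  have h1 : ∀ p : ℝ × ℝ × ℝ, Complex.exp (2 * Real.pi * Complex.I * (α * SX p))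
      = E p.1 * (fun q : ℝ × ℝ => E q.1 * E q.2) p.2 := by
    intro p
    simp only [hE, SX]
    rw [← Complex.exp_add, ← Complex.exp_add]
    push_cast
    ring_nf
  simp_rw [h1]
  unfold mX
  have h2 := integral_prod_mul (μ := nuX X) (ν := (nuX X).prod (nuX X)) E
    (fun q : ℝ × ℝ => E q.1 * E q.2)
  have h3 := integral_prod_mul (μ := nuX X) (ν := nuX X) E E
  rw [h2, h3, ← h0]
  ring

lemma fourier_id {X : ℝ} (hX : 2 ≤ X) (N ε : ℝ) (ψ : ℝ → ℝ) (hc : Continuous ψ)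
    (hb : ∀ y, |ψ y| ≤ 1) (hs : ∀ y, ε ≤ |y| → ψ y = 0) :
    (∫ α : ℝ, (Iint X α) ^ 3 * Complex.exp (-(2 * Real.pi * Complex.I * (N * α))) *
      (∫ y : ℝ, (ψ y : ℂ) * Complex.exp (-(2 * Real.pi * Complex.I * (α * y))))) =
    ((∫ p, ψ (SX p - N) ∂(mX X) : ℝ) : ℂ) := by
  have hsupp : HasCompactSupport ψ := by
    apply HasCompactSupport.of_support_subset_isCompact (isCompact_Icc (a := -ε) (b := ε))
    intro y hy
    by_contra h
    apply hy
    apply hs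
    by_contra h'
    push Not at h'
    exact h (abs_le.mp h'.le)
  have hψi : Integrable ψ := hc.integrable_of_hasCompactSupport hsupp
  have hψi' : Integrable (fun y => (ψ y : ℂ)) := hψi.ofReal
  set h : ℝ → ℂ := fun u => ∫ p, (ψ (SX p - u) : ℂ) ∂(mX X) with hh
  have hprod : Integrable (fun q : ℝ × (ℝ × ℝ × ℝ) => (ψ (SX q.2 - q.1) : ℂ))
      (volume.prod (mX X)) := by
    rw [integrable_prod_iff']
    · constructor
      · exact Eventually.of_forall (fun p => hψi'.comp_sub_left (SX p))
      · have : ∀ p : ℝ × ℝ × ℝ, ∫ x : ℝ, ‖(ψ (SX p - x) : ℂ)‖ = ∫ x : ℝ, ‖(ψ x : ℂ)‖ :=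
          fun p => integral_sub_left_eq_self (fun x => ‖(ψ x : ℂ)‖) volume (SX p)
        simp_rw [this]
        exact integrable_const _
    · have := SX_cont
      exact (by fun_prop : Continuous (fun q : ℝ × (ℝ × ℝ × ℝ) =>
        (ψ (SX q.2 - q.1) : ℂ))).aestronglyMeasurable
  have hhi : Integrable h := hprod.integral_prod_left
  have hhc : Continuous h := by
    have := SX_cont
    apply continuous_of_dominated (bound := fun _ => 1)
    · intro u
      exact (by fun_prop : Continuous (fun p => (ψ (SX p - u) : ℂ))).aestronglyMeasurable
    · intro u
      refine Eventually.of_forall (fun p => ?_)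
      rw [Complex.norm_real]; exact hb _
    · exact integrable_const _
    · refine Eventually.of_forall (fun p => ?_)
      fun_prop
  have hF : ∀ α : ℝ, 𝓕⁻ h α = (Iint X α) ^ 3 *
      (∫ y : ℝ, (ψ y : ℂ) * Complex.exp (-(2 * Real.pi * Complex.I * (α * y)))) := by
    intro α
    rw [Real.fourierInv_eq', Iint_cube hX, ← integral_mul_const]
    have e1 : ∀ u : ℝ, Complex.exp (↑(2 * Real.pi * inner ℝ u α) * Complex.I) • h u =
        ∫ p, Complex.exp (↑(2 * Real.pi * (u * α)) * Complex.I) * (ψ (SX p - u) : ℂ) ∂(mX X) := by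
      intro u
      simp only [hh]
      rw [integral_const_mul, smul_eq_mul]
      congr 4
      simp [mul_comm]
    simp_rw [e1]
    rw [integral_integral_swap]
    · congr 1
      ext p
      rw [← integral_const_mul]
      rw [← integral_sub_left_eq_self _ volume (SX p)]
      congr 1
      ext y
      rw [sub_sub_cancel, mul_left_comm (Complex.exp (2 * Real.pi * Complex.I * (α * SX p))),
        ← Complex.exp_add, mul_comm]
      congr 2
      push_cast
      ring
    · have hm : AEStronglyMeasurable (fun q : ℝ × (ℝ × ℝ × ℝ) =>
          Complex.exp (↑(2 * Real.pi * (q.1 * α)) * Complex.I)) (volume.prod (mX X)) :=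
        (by fun_prop : Continuous (fun q : ℝ × (ℝ × ℝ × ℝ) =>
          Complex.exp (↑(2 * Real.pi * (q.1 * α)) * Complex.I))).aestronglyMeasurable
      exact hprod.bdd_mul (c := 1) hm
        (Eventually.of_forall (fun q => (Complex.norm_exp_ofReal_mul_I _).le))
  have hFb : ∀ α : ℝ, ‖𝓕⁻ h α‖ ≤ ((2 + 2 * X) ^ 2 * X * ∫ y, |ψ y|) * (1 + α ^ 2)⁻¹ := by
    intro α
    rw [hF, norm_mul, norm_pow]
    have b1 : ‖∫ y : ℝ, (ψ y : ℂ) * Complex.exp (-(2 * Real.pi * Complex.I * (α * y)))‖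
        ≤ ∫ y, |ψ y| := by
      refine (norm_integral_le_integral_norm _).trans (le_of_eq ?_)
      congr 1
      ext y
      rw [norm_mul, Complex.norm_real,
        show (-(2 * Real.pi * Complex.I * (α * y)) : ℂ)
        = ((-(2 * Real.pi * (α * y)) : ℝ) : ℂ) * Complex.I by push_cast; ring,
        Complex.norm_exp_ofReal_mul_I, mul_one, Real.norm_eq_abs]
    have b2 := Iint_bound' hX α
    have b3 : ‖Iint X α‖ * |α| ≤ 2 + X := by
      by_cases hα : α = 0
      · simp [hα]; linarith
      · exact Iint_bound hX hα
    have b4 : ‖Iint X α‖ * (1 + |α|) ≤ 2 + 2 * X := by nlinarith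
    have b0 := norm_nonneg (Iint X α)
    have ha := abs_nonneg α
    have b5 : ‖Iint X α‖ ^ 2 * (1 + α ^ 2) ≤ (2 + 2 * X) ^ 2 := by
      calc ‖Iint X α‖ ^ 2 * (1 + α ^ 2) ≤ (‖Iint X α‖ * (1 + |α|)) ^ 2 := by
            rw [mul_pow, ← sq_abs α]
            gcongr
            nlinarith
        _ ≤ _ := by gcongr
    have hpos : (0 : ℝ) < 1 + α ^ 2 := by positivity
    rw [← div_eq_mul_inv, le_div_iff₀ hpos]
    have hI0 : 0 ≤ ∫ y, |ψ y| := integral_nonneg (fun y => abs_nonneg _)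
    calc _ = (‖Iint X α‖ ^ 2 * (1 + α ^ 2)) * ‖Iint X α‖ *
        ‖∫ y : ℝ, (ψ y : ℂ) * Complex.exp (-(2 * Real.pi * Complex.I * (α * y)))‖ := by ring
      _ ≤ _ := by gcongr
  have hFc : Continuous (𝓕 h) := 
    VectorFourier.fourierIntegral_continuous Real.continuous_fourierChar
      (by exact continuous_inner) hhi
  have hFi : Integrable (𝓕 h) := by
    refine Integrable.mono' (integrable_inv_one_add_sq.const_mul
      ((2 + 2 * X) ^ 2 * X * ∫ y, |ψ y|)) hFc.aestronglyMeasurable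
      (Eventually.of_forall (fun α => ?_))
    have := hFb (-α)
    rw [Real.fourierInv_eq_fourier_neg, neg_neg, neg_sq] at this
    exact this
  have hinv := congrFun (hhc.fourier_fourierInv_eq hhi hFi) N
  rw [Real.fourier_eq'] at hinv
  have : h N = ((∫ p, ψ (SX p - N) ∂(mX X) : ℝ) : ℂ) := by
    simp only [hh]
    exact integral_ofReal
  rw [← this, ← hinv]
  congr 1
  ext α
  rw [hF, smul_eq_mul]
  have : Complex.exp (-(2 * Real.pi * Complex.I * (N * α))) =
      Complex.exp (↑(-2 * Real.pi * inner ℝ α N) * Complex.I) := by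
    congr 1
    simp
    ring
  rw [this]
  ring

lemma F_mvt {X x y : ℝ} (hX : 2 ≤ X) (hx : X / 2 ≤ x) (hxy : x ≤ y) (hy : y ≤ X) :
    Real.log X * (y - x) ≤ y * Real.log y - x * Real.log x ∧
    y * Real.log y - x * Real.log x ≤ (1 + Real.log X) * (y - x) := by
  have hd : DifferentiableOn ℝ (fun x => x * Real.log x) (interior (Icc (X / 2) X)) := by
    intro z hz
    rw [interior_Icc] at hz
    exact (Real.hasDerivAt_mul_log (by linarith [hz.1] : z ≠ 0)).differentiableAt.differentiableWithinAt
  constructor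
  · refine (convex_Icc (X / 2) X).mul_sub_le_image_sub_of_le_deriv
      Real.continuous_mul_log.continuousOn hd ?_ x ⟨hx, by linarith⟩ y ⟨by linarith, hy⟩ hxy
    intro z hz
    rw [interior_Icc] at hz
    rw [(Real.hasDerivAt_mul_log (by linarith [hz.1] : z ≠ 0)).deriv]
    have h1 : Real.log (X / 2) ≤ Real.log z := Real.log_le_log (by linarith) hz.1.le
    rw [Real.log_div (by linarith) (by norm_num)] at h1
    linarith [Real.log_two_lt_d9]
  · refine (convex_Icc (X / 2) X).image_sub_le_mul_sub_of_deriv_le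
      Real.continuous_mul_log.continuousOn hd ?_ x ⟨hx, by linarith⟩ y ⟨by linarith, hy⟩ hxy
    intro z hz
    rw [interior_Icc] at hz
    rw [(Real.hasDerivAt_mul_log (by linarith [hz.1] : z ≠ 0)).deriv]
    have h1 : Real.log z ≤ Real.log X := Real.log_le_log (by linarith [hz.1]) hz.2.le
    linarith

lemma F_abs {X x y d : ℝ} (hX : 2 ≤ X) (hL : 1 ≤ Real.log X) (hx : X / 2 ≤ x) (hx' : x ≤ X)
    (hy : X / 2 ≤ y) (hy' : y ≤ X) (hd : |y - x| ≤ d) :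
    |y * Real.log y - x * Real.log x| ≤ 2 * Real.log X * d := by
  rw [abs_le] at hd
  rcases le_total x y with h | h
  · obtain ⟨h1, h2⟩ := F_mvt hX hx h hy'
    rw [abs_le]; constructor <;> nlinarith
  · obtain ⟨h1, h2⟩ := F_mvt hX hy h hx'
    rw [abs_le]; constructor <;> nlinarith

lemma nuX_Icc {X a b : ℝ} (ha : X / 2 < a) (hb : b ≤ X) :
    nuX X (Icc a b) = ENNReal.ofReal (b - a) := by
  unfold nuX
  rw [Measure.restrict_apply measurableSet_Icc, inter_eq_left.mpr, Real.volume_Icc]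
  intro z hz
  exact ⟨by linarith [hz.1], by linarith [hz.2]⟩

lemma section_bound {X ε y₁ y₂ : ℝ} (hX : 2 ≤ X) (hL : 1 ≤ Real.log X) (hε : 0 < ε)
    (hs : ε / (4 * Real.log X) ≤ X / 100)
    (h1 : y₁ ∈ Icc (2 * X / 3 - X / 100) (2 * X / 3 + X / 100))
    (h2 : y₂ ∈ Icc (2 * X / 3 - X / 100) (2 * X / 3 + X / 100)) :
    ENNReal.ofReal (ε / (2 * Real.log X)) ≤
      nuX X {y₃ | |SX (y₁, y₂, y₃) - 2 * X * Real.log (2 * X / 3)| ≤ 3 * ε / 4} := by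
  set L := Real.log X with hLdef
  set a := 2 * X / 3 with ha
  have e1 := F_abs (x := a) (y := y₁) (d := X / 100) hX hL (by linarith) (by linarith)
    (by linarith [h1.1]) (by linarith [h1.2]) (abs_le.mpr ⟨by linarith [h1.1], by linarith [h1.2]⟩)
  have e2 := F_abs (x := a) (y := y₂) (d := X / 100) hX hL (by linarith) (by linarith)
    (by linarith [h2.1]) (by linarith [h2.2]) (abs_le.mpr ⟨by linarith [h2.1], by linarith [h2.2]⟩)
  rw [← hLdef] at e1 e2
  have f1 := (F_mvt (x := a) (y := 9 * X / 10) hX (by linarith) (by linarith) (by linarith)).1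
  have f2 := (F_mvt (x := 11 * X / 20) (y := a) hX (by linarith) (by linarith) (by linarith)).1
  rw [← hLdef] at f1 f2
  have hN : 2 * X * Real.log a = 3 * (a * Real.log a) := by rw [ha]; ring
  rw [abs_le] at e1 e2
  have hXL : 0 < X * L := by positivity
  have hr1 : L * (9 * X / 10 - a) = (7 / 30) * (X * L) := by rw [ha]; ring
  have hr2 : L * (a - 11 * X / 20) = (7 / 60) * (X * L) := by rw [ha]; ring
  have hr3 : 2 * L * (X / 100) = (1 / 50) * (X * L) := by ring
  rw [hr3] at e1 e2
  rw [hr1] at f1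
  rw [hr2] at f2
  have hivt := intermediate_value_Icc (f := fun x => x * Real.log x)
    (by linarith : 11 * X / 20 ≤ 9 * X / 10) Real.continuous_mul_log.continuousOn
  obtain ⟨z, hz, hz'⟩ := hivt (show 2 * X * Real.log a - y₁ * Real.log y₁ - y₂ * Real.log y₂ ∈ _ from
    ⟨by linarith [e1.1, e1.2, e2.1, e2.2],
     by linarith [e1.1, e1.2, e2.1, e2.2]⟩)
  simp only at hz'
  set δ := ε / (4 * L) with hδ
  have hδ0 : 0 < δ := by positivity
  have hδL : 2 * L * δ = ε / 2 := by rw [hδ]; field_simp; norm_num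
  have : ε / (2 * L) = (z + δ) - (z - δ) := by rw [hδ]; field_simp; ring
  rw [this, ← nuX_Icc (X := X) (by linarith [hz.1]) (by linarith [hz.2])]
  apply measure_mono
  intro y hy
  have g := F_abs (x := z) (y := y) (d := δ) hX hL (by linarith [hz.1]) (by linarith [hz.2])
    (by linarith [hz.1, hy.1]) (by linarith [hz.2, hy.2])
    (abs_le.mpr ⟨by linarith [hy.1], by linarith [hy.2]⟩)
  rw [← hLdef, hδL] at g
  simp only [mem_ofPred_eq, SX]
  rw [show y₁ * Real.log y₁ + (y₂ * Real.log y₂ + y * Real.log y) - 2 * X * Real.log a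
    = y * Real.log y - z * Real.log z by rw [hz']; ring]
  linarith

lemma vol_bound {X ε : ℝ} (hX : 2 ≤ X) (hL : 1 ≤ Real.log X) (hε : 0 < ε)
    (hs : ε / (4 * Real.log X) ≤ X / 100) :
    ENNReal.ofReal (ε / (2 * Real.log X)) * ENNReal.ofReal (X / 50) * ENNReal.ofReal (X / 50) ≤
      mX X {p | |SX p - 2 * X * Real.log (2 * X / 3)| ≤ 3 * ε / 4} := by
  have hcont := SX_cont
  set B := Icc (2 * X / 3 - X / 100) (2 * X / 3 + X / 100) with hB
  have hBm : nuX X B = ENNReal.ofReal (X / 50) := by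
    rw [hB, nuX_Icc (by linarith) (by linarith)]
    congr 1
    ring
  have hA : MeasurableSet {p | |SX p - 2 * X * Real.log (2 * X / 3)| ≤ 3 * ε / 4} :=
    (isClosed_le (by fun_prop) continuous_const).measurableSet
  unfold mX
  rw [Measure.prod_apply hA]
  have hstep : ∀ y₁ ∈ B, ENNReal.ofReal (ε / (2 * Real.log X)) * ENNReal.ofReal (X / 50) ≤
      ((nuX X).prod (nuX X)) (Prod.mk y₁ ⁻¹' {p | |SX p - 2 * X * Real.log (2 * X / 3)| ≤ 3 * ε / 4}) := by
    intro y₁ h1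
    rw [Measure.prod_apply (measurable_prodMk_left hA), ← hBm, ← setLIntegral_const]
    refine le_trans (setLIntegral_mono' measurableSet_Icc (fun y₂ h2 => ?_))
      (setLIntegral_le_lintegral B _)
    exact section_bound hX hL hε hs h1 h2
  nth_rewrite 2 [← hBm]
  rw [← setLIntegral_const]
  exact le_trans (setLIntegral_mono' measurableSet_Icc hstep) (setLIntegral_le_lintegral B _)

theorem stmt19 :
    ∃ c : ℝ, 0 < c ∧ ∃ X₀ : ℝ, ∀ X : ℝ, X ≥ X₀ →
      ∀ (k : ℕ), 0 < k → ∀ ψ : ℝ → ℝ, ContDiff ℝ k ψ →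
      (∀ y : ℝ, |y| ≤ 3 * (X ^ (-(1 : ℝ) / 25) * Real.log X ^ 8) / 4 → ψ y = 1) →
      (∀ y : ℝ, 3 * (X ^ (-(1 : ℝ) / 25) * Real.log X ^ 8) / 4 < |y| →
        |y| < X ^ (-(1 : ℝ) / 25) * Real.log X ^ 8 → 0 ≤ ψ y ∧ ψ y < 1) →
      (∀ y : ℝ, X ^ (-(1 : ℝ) / 25) * Real.log X ^ 8 ≤ |y| → ψ y = 0) →
      c * (X ^ (-(1 : ℝ) / 25) * Real.log X ^ 8) * X ^ 2 / Real.log X ≤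
        (∫ α : ℝ, (Iint X α) ^ 3 *
            Complex.exp (-(2 * Real.pi * Complex.I * (2 * X * Real.log (2 * X / 3) * α))) *
            (∫ y : ℝ, (ψ y : ℂ) * Complex.exp (-(2 * Real.pi * Complex.I * (α * y))))).re := by
  refine ⟨1 / 5000, by norm_num, ?_⟩
  have hlo := (Real.isLittleO_pow_log_id_atTop (n := 7)).def (by norm_num : (0 : ℝ) < 1 / 25)
  obtain ⟨X₁, hX₁⟩ := eventually_atTop.mp hlo
  refine ⟨max X₁ 3, fun X hX k _ ψ hψ h1 h2 h3 => ?_⟩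
  have hX1 : X₁ ≤ X := le_trans (le_max_left _ _) hX
  have hX3 : 3 ≤ X := le_trans (le_max_right _ _) hX
  have hL : 1 ≤ Real.log X := by
    rw [Real.le_log_iff_exp_le (by linarith)]
    linarith [Real.exp_one_lt_d9]
  have hb := hX₁ X hX1
  simp only [id, Real.norm_eq_abs] at hb
  rw [abs_of_nonneg (by positivity), abs_of_nonneg (by linarith)] at hb
  set ε := X ^ (-(1 : ℝ) / 25) * Real.log X ^ 8 with hε
  have hr : X ^ (-(1 : ℝ) / 25) ≤ 1 :=
    Real.rpow_le_one_of_one_le_of_nonpos (by linarith) (by norm_num)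
  have hr0 : 0 < X ^ (-(1 : ℝ) / 25) := Real.rpow_pos_of_pos (by linarith) _
  have hε0 : 0 < ε := by positivity
  have hs : ε / (4 * Real.log X) ≤ X / 100 := by
    have : ε / (4 * Real.log X) = X ^ (-(1 : ℝ) / 25) * Real.log X ^ 7 / 4 := by
      rw [hε]; field_simp
    rw [this]
    have : X ^ (-(1 : ℝ) / 25) * Real.log X ^ 7 ≤ 1 * Real.log X ^ 7 := by gcongr
    linarith
  have hψ01 : ∀ y, 0 ≤ ψ y ∧ ψ y ≤ 1 := by
    intro y
    rcases le_or_gt |y| (3 * ε / 4) with h | h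
    · rw [h1 y h]; norm_num
    · rcases lt_or_ge |y| ε with h' | h'
      · exact ⟨(h2 y h h').1, (h2 y h h').2.le⟩
      · rw [h3 y h']; norm_num
  have hid := fourier_id (X := X) (by linarith) (2 * X * Real.log (2 * X / 3)) ε ψ hψ.continuous
    (fun y => by rw [abs_of_nonneg (hψ01 y).1]; exact (hψ01 y).2) h3
  push_cast at hid
  rw [hid, Complex.ofReal_re]
  set N := 2 * X * Real.log (2 * X / 3) with hN
  set A : Set (ℝ × ℝ × ℝ) := {p | |SX p - N| ≤ 3 * ε / 4} with hA
  have hcont := SX_cont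
  have hψc := hψ.continuous
  have hAm : MeasurableSet A := (isClosed_le (by fun_prop) continuous_const).measurableSet
  have hvol := vol_bound (X := X) (by linarith) hL hε0 hs
  rw [← hN, ← hA, ← ENNReal.ofReal_mul (by positivity), ← ENNReal.ofReal_mul (by positivity)] at hvol
  have hvol' := (ENNReal.ofReal_le_iff_le_toReal (measure_ne_top _ _)).mp hvol
  have hbnd : ∫ p, A.indicator (fun _ => (1 : ℝ)) p ∂(mX X) ≤ ∫ p, ψ (SX p - N) ∂(mX X) := by
    apply integral_mono
    · exact (integrable_const _).indicator hAm
    · refine Integrable.of_bound (C := 1)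
        (by fun_prop : Continuous (fun p => ψ (SX p - N))).aestronglyMeasurable
        (Eventually.of_forall (fun p => ?_))
      rw [Real.norm_eq_abs, abs_of_nonneg (hψ01 _).1]
      exact (hψ01 _).2
    · intro p
      by_cases hp : p ∈ A
      · rw [indicator_of_mem hp]
        exact (h1 _ hp).ge
      · rw [indicator_of_notMem hp]
        exact (hψ01 _).1
  rw [integral_indicator_const _ hAm, smul_eq_mul, mul_one] at hbnd
  refine le_trans (le_of_eq ?_) (hvol'.trans hbnd)
  field_simp
  norm_num
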